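/- Fix a positive integer m and dimension d, and let σ(x) = Sigmoid(x) = 1/(1+exp(−x)) or σ(x) = tanh(x). There exists a finite point set X ⊂ ℝ^d with cardinality #X = (C(4m,2)·(d−1)+1)·2^{2m} (where C(4m,2) is the binomial coefficient '4m choose 2') such that: for any two irreducible shallow analytic networks f_N(x) = Σ_{k=1}^m s_k·σ(⟨a_k,x⟩+b_k) + c and f_{N'}(x) = Σ_{k=1}^m s'_k·σ(⟨a'_k,x⟩+b'_k) + c', each with m neurons, if f_N(x) = f_{N'}(x) for all x ∈ X, then f_N(x) = f_{N'}(x) for all x ∈ ℝ^d. -/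

import Mathlib

open Finset

/-- The logistic sigmoid function. -/
noncomputable def sigmoid (x : ℝ) : ℝ := 1 / (1 + Real.exp (-x))

/-- Dot product on `ℝ^d`. -/
noncomputable def dotp {d : ℕ} (a x : Fin d → ℝ) : ℝ := ∑ i, a i * x i

/-- A shallow network with activation `σ` and `m` neurons. -/
noncomputable def shallowNet {d m : ℕ} (σ : ℝ → ℝ) (a : Fin m → Fin d → ℝ)
    (b s : Fin m → ℝ) (c : ℝ) (x : Fin d → ℝ) : ℝ :=
  (∑ k, s k * σ (dotp (a k) x + b k)) + c

/-- `f`, viewed as a network with activation `σ` and `m` neurons, is irreducible: no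
shallow network with activation `σ` and fewer than `m` neurons agrees with `f`
everywhere. -/
def IrreducibleShallow {d : ℕ} (σ : ℝ → ℝ) (m : ℕ) (f : (Fin d → ℝ) → ℝ) : Prop :=
  ¬ ∃ m' < m, ∃ (a : Fin m' → Fin d → ℝ) (b s : Fin m' → ℝ) (c : ℝ),
    ∀ x, shallowNet σ a b s c x = f x


lemma vand {I : Type*} (T : Finset I) (N : ℕ) (hN : T.card ≤ N) (C : I → ℂ) (lam : I → ℝ)
    (h : ∀ j ∈ range N, ∑ i ∈ T, C i * Complex.exp ((lam i : ℂ) * ((j : ℂ) + 1)) = 0) (z : ℂ) :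
    ∑ i ∈ T, C i * Complex.exp ((lam i : ℂ) * z) = 0 := by
  classical
  rcases T.eq_empty_or_nonempty with rfl | hT
  · simp
  set x : I → ℂ := fun i => Complex.exp (lam i) with hx
  set r : ℂ → ℂ := fun y => Complex.exp (z * Complex.log y) / y with hr
  set s := T.image x with hs
  set p := Lagrange.interpolate s id r with hp
  have hinj : Set.InjOn (id : ℂ → ℂ) s := Function.injective_id.injOn
  have hspos : 0 < s.card := Finset.card_pos.mpr (hT.image x)
  have hdeg : p.natDegree < N := by
    have h1 : p.degree < s.card := Lagrange.degree_interpolate_lt r hinj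
    have h2 : s.card ≤ N := le_trans Finset.card_image_le hN
    by_cases hp0 : p = 0
    · rw [hp0, Polynomial.natDegree_zero]; omega
    · rw [Polynomial.degree_eq_natDegree hp0] at h1
      have : p.natDegree < s.card := by exact_mod_cast h1
      omega
  have hev : ∀ i ∈ T, p.eval (x i) = r (x i) := by
    intro i hi
    have := Lagrange.eval_interpolate_at_node (s := s) (v := id) r hinj
      (Finset.mem_image_of_mem x hi)
    exact this
  have hlog : ∀ i, Complex.log (x i) = lam i := by
    intro i
    rw [hx]
    apply Complex.log_exp
    · simp [Real.pi_pos]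
    · simp [Real.pi_pos.le]
  have key : ∀ i ∈ T, C i * Complex.exp ((lam i : ℂ) * z)
      = ∑ j ∈ range N, p.coeff j * (C i * Complex.exp ((lam i : ℂ) * ((j : ℂ) + 1))) := by
    intro i hi
    have hxi : x i ≠ 0 := Complex.exp_ne_zero _
    have h1 : Complex.exp ((lam i : ℂ) * z) = x i * p.eval (x i) := by
      rw [hev i hi, hr]
      simp only
      rw [hlog, mul_comm z]
      field_simp
    rw [h1, Polynomial.eval_eq_sum_range' hdeg, Finset.mul_sum, Finset.mul_sum]
    refine Finset.sum_congr rfl fun j _ => ?_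
    have : Complex.exp ((lam i : ℂ) * ((j : ℂ) + 1)) = x i ^ j * x i := by
      rw [hx]
      simp only
      rw [← Complex.exp_nat_mul, ← Complex.exp_add]
      congr 1; ring
    rw [this]; ring
  rw [Finset.sum_congr rfl key, Finset.sum_comm]
  refine Finset.sum_eq_zero fun j hj => ?_
  rw [← Finset.mul_sum, h j hj, mul_zero]

noncomputable def cleared {ι : Type*} [DecidableEq ι] (K : Finset ι) (s : ι → ℂ) (c : ℂ)
    (E : ι → ℂ) : ℂ :=
  ∑ k ∈ K, s k * ∏ j ∈ K.erase k, (1 + E j) + c * ∏ j ∈ K, (1 + E j)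

lemma cleared_expand {ι : Type*} [DecidableEq ι] (K : Finset ι) (s : ι → ℂ) (c : ℂ)
    (E : ι → ℂ) : cleared K s c E =
      ∑ S ∈ K.powerset, (∑ k ∈ K, (if k ∈ S then 0 else s k) + c) * ∏ j ∈ S, E j := by
  unfold cleared
  simp only [add_mul, Finset.sum_add_distrib, Finset.prod_one_add, Finset.sum_mul, Finset.mul_sum]
  congr 1
  rw [Finset.sum_comm]
  refine Finset.sum_congr rfl fun k hk => ?_
  have : (K.erase k).powerset = K.powerset.filter (fun S => k ∉ S) := by
    ext S
    simp only [Finset.mem_powerset, Finset.mem_filter, Finset.subset_erase]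
  rw [this, Finset.sum_filter]
  refine Finset.sum_congr rfl fun S _ => ?_
  by_cases h : k ∈ S <;> simp [h]

lemma cleared_eq {ι : Type*} [DecidableEq ι] (K : Finset ι) (s : ι → ℂ) (c : ℂ)
    (E : ι → ℂ) (hE : ∀ k ∈ K, 1 + E k ≠ 0) : cleared K s c E =
      (∑ k ∈ K, s k * (1 / (1 + E k)) + c) * ∏ j ∈ K, (1 + E j) := by
  unfold cleared
  rw [add_mul, Finset.sum_mul]
  congr 1
  refine Finset.sum_congr rfl fun k hk => ?_
  rw [← Finset.mul_prod_erase K _ hk]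
  have := hE k hk
  field_simp

noncomputable def EE {ι : Type*} (al b : ι → ℝ) (z : ℂ) (k : ι) : ℂ :=
  Complex.exp (-((al k : ℂ) * z + b k))

lemma EE_real {ι : Type*} (al b : ι → ℝ) (t : ℝ) (k : ι) :
    1 / (1 + EE al b t k) = (sigmoid (al k * t + b k) : ℝ) := by
  simp [EE, sigmoid]

lemma EE_ne {ι : Type*} (al b : ι → ℝ) (t : ℝ) (k : ι) : 1 + EE al b t k ≠ 0 := by
  have : 1 + EE al b t k = ((1 + Real.exp (-(al k * t + b k)) : ℝ) : ℂ) := by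
    simp [EE]
  rw [this]
  have := Real.exp_pos (-(al k * t + b k))
  exact_mod_cast (by positivity : (1 + Real.exp (-(al k * t + b k)) : ℝ) ≠ 0)

lemma cleared_real {ι : Type*} [DecidableEq ι] (K : Finset ι) (al b s : ι → ℝ) (c t : ℝ) :
    cleared K (fun k => (s k : ℂ)) c (EE al b t) = 0 ↔
      ∑ k ∈ K, s k * sigmoid (al k * t + b k) + c = 0 := by
  rw [cleared_eq _ _ _ _ (fun k _ => EE_ne al b t k), mul_eq_zero,
    or_iff_left (Finset.prod_ne_zero_iff.mpr fun k _ => EE_ne al b t k)]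
  simp only [EE_real]
  norm_cast

lemma cleared_zero {ι : Type*} [DecidableEq ι] (K : Finset ι) (al b s : ι → ℝ) (c : ℝ)
    (h : ∀ j ∈ range (2 ^ K.card),
      ∑ k ∈ K, s k * sigmoid (al k * ((j : ℝ) + 1) + b k) + c = 0) (z : ℂ) :
    cleared K (fun k => (s k : ℂ)) c (EE al b z) = 0 := by
  have hprod : ∀ (S : Finset ι) (z : ℂ), ∏ j ∈ S, EE al b z j =
      Complex.exp (-∑ j ∈ S, (b j : ℂ)) * Complex.exp (((-∑ j ∈ S, al j : ℝ) : ℂ) * z) := by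
    intro S z
    unfold EE
    rw [← Complex.exp_sum, ← Complex.exp_add]
    congr 1
    push_cast
    rw [Finset.sum_neg_distrib, Finset.sum_add_distrib, ← Finset.sum_mul]
    ring
  have hexp : ∀ z : ℂ, cleared K (fun k => (s k : ℂ)) c (EE al b z) =
      ∑ S ∈ K.powerset, ((∑ k ∈ K, (if k ∈ S then 0 else (s k : ℂ)) + c) *
        Complex.exp (-∑ j ∈ S, (b j : ℂ))) * Complex.exp (((-∑ j ∈ S, al j : ℝ) : ℂ) * z) := by
    intro z
    rw [cleared_expand]
    refine Finset.sum_congr rfl fun S _ => ?_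
    rw [hprod, mul_assoc]
  rw [hexp]
  apply vand K.powerset (2 ^ K.card) (by rw [Finset.card_powerset])
    (fun S => (∑ k ∈ K, (if k ∈ S then 0 else (s k : ℂ)) + c) *
        Complex.exp (-∑ j ∈ S, (b j : ℂ))) (fun S => -∑ j ∈ S, al j)
  intro j hj
  have h1 := (cleared_real K al b s c ((j : ℝ) + 1)).mpr (h j hj)
  rw [hexp] at h1
  push_cast at h1 ⊢
  exact h1

lemma all_real {ι : Type*} [DecidableEq ι] (K : Finset ι) (al b s : ι → ℝ) (c : ℝ)
    (h : ∀ j ∈ range (2 ^ K.card),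
      ∑ k ∈ K, s k * sigmoid (al k * ((j : ℝ) + 1) + b k) + c = 0) (t : ℝ) :
    ∑ k ∈ K, s k * sigmoid (al k * t + b k) + c = 0 :=
  (cleared_real K al b s c t).mp (cleared_zero K al b s c h t)

lemma sigmoid_neg' (x : ℝ) : sigmoid (-x) = 1 - sigmoid x := by
  unfold sigmoid
  rw [neg_neg, Real.exp_neg]
  have := Real.exp_pos x
  field_simp
  ring

lemma pole_sep (al be b b' : ℝ) (hal : al ≠ 0) (hle : |be| ≤ |al|)
    (h : 1 + Complex.exp (-((be : ℂ) * ((Real.pi * Complex.I - b) / al) + b')) = 0) :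
    (be = al ∧ b' = b) ∨ (be = -al ∧ b' = -b) := by
  have h1 : Complex.exp (-((be : ℂ) * ((Real.pi * Complex.I - b) / al) + b'))
      = Complex.exp (Real.pi * Complex.I) := by
    rw [Complex.exp_pi_mul_I]; linear_combination h
  obtain ⟨n, hn⟩ := Complex.exp_eq_exp_iff_exists_int.mp h1
  have halC : (al : ℂ) ≠ 0 := by exact_mod_cast hal
  have h2 : -((be : ℂ) * (Real.pi * Complex.I - b) + b' * al)
      = al * (Real.pi * Complex.I + n * (2 * Real.pi * Complex.I)) := by
    rw [← hn]; field_simp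
  have hre := congrArg Complex.re h2
  have him := congrArg Complex.im h2
  simp at hre him
  have hbe : be = -al * (2 * n + 1) := by
    have := Real.pi_ne_zero
    apply mul_right_cancel₀ this
    linear_combination -him
  have hn1 : |(2 * n + 1 : ℝ)| ≤ 1 := by
    rw [hbe, abs_mul, abs_neg] at hle
    have : 0 < |al| := abs_pos.mpr hal
    nlinarith
  rw [abs_le] at hn1
  have ha : -1 ≤ n := by
    have : (-1 : ℝ) ≤ n := by linarith
    exact_mod_cast this
  have hb : n ≤ 0 := by
    have : (n : ℝ) ≤ 0 := by linarith
    exact_mod_cast this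
  have : n = -1 ∨ n = 0 := by omega
  rcases this with rfl | rfl
  · left
    have e : be = al := by rw [hbe]; push_cast; ring
    refine ⟨e, mul_right_cancel₀ hal ?_⟩
    rw [e] at hre
    linarith
  · right
    have e : be = -al := by rw [hbe]; push_cast; ring
    refine ⟨e, mul_right_cancel₀ hal ?_⟩
    rw [e] at hre
    linarith

lemma main_ind {ι : Type*} [DecidableEq ι] {d : ℕ} (a : ι → Fin d → ℝ) (b al : ι → ℝ)
    (hp : ∀ k l, al k = al l → a k = a l) (hn : ∀ k l, al k = - al l → a k = - a l)
    (n : ℕ) : ∀ (K : Finset ι), K.card = n → ∀ (s : ι → ℝ) (c : ℝ),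
    (∀ t : ℝ, ∑ k ∈ K, s k * sigmoid (al k * t + b k) + c = 0) →
    ∀ x : Fin d → ℝ, ∑ k ∈ K, s k * sigmoid (dotp (a k) x + b k) + c = 0 := by
  induction n with
  | zero =>
    intro K hK s c h x
    rw [Finset.card_eq_zero] at hK
    subst hK
    simpa using h 0
  | succ n ih =>
    intro K hK s c h x
    have hne : K.Nonempty := Finset.card_pos.mp (by omega)
    obtain ⟨k, hk, hmax⟩ := Finset.exists_max_image K (fun k => |al k|) hne
    -- generic removal
    have remove : ∀ l ∈ K, ∀ (s2 : ι → ℝ) (c2 : ℝ),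
        (∀ y : ι → ℝ, (∀ k l, al k = al l → b k = b l → y k = y l) →
          (∀ k l, al k = -al l → b k = - b l → y k = - y l) →
          (∀ k, al k = 0 → y k = b k) →
          ∑ k ∈ K, s k * sigmoid (y k) + c = ∑ k ∈ K.erase l, s2 k * sigmoid (y k) + c2) →
        ∑ k ∈ K, s k * sigmoid (dotp (a k) x + b k) + c = 0 := by
      intro l hl s2 c2 hy
      rw [hy]
      · apply ih (K.erase l) (by rw [Finset.card_erase_of_mem hl]; omega)
        intro t
        rw [← hy, h t]
        · intro k l h1 h2; simp only [h1, h2]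
        · intro k l h1 h2; simp only [h1, h2]; ring
        · intro k h1; simp [h1]
      · intro k l h1 h2; simp only [hp k l h1, h2]
      · intro k l h1 h2; simp only [hn k l h1, h2, dotp, Pi.neg_apply, neg_mul,
          Finset.sum_neg_distrib]; ring
      · intro k h1
        have h0 : a k = 0 := by
          have := hn k k (by rw [h1, neg_zero])
          exact self_eq_neg.mp this
        simp [h0, dotp]
    by_cases h0 : al k = 0
    · apply remove k hk s (c + s k * sigmoid (b k))
      intro y _ _ hy
      rw [← Finset.add_sum_erase K _ hk, hy k h0]; ring
    by_cases hl : ∃ l ∈ K, l ≠ k ∧ ((al l = al k ∧ b l = b k) ∨ (al l = - al k ∧ b l = - b k))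
    · obtain ⟨l, hlK, hlk, hcase⟩ := hl
      have hkl : k ∈ K.erase l := Finset.mem_erase.mpr ⟨hlk.symm, hk⟩
      have hupd : ∀ (v : ℝ) (y : ι → ℝ), ∑ i ∈ (K.erase l).erase k,
          (Function.update s k v) i * sigmoid (y i) =
          ∑ i ∈ (K.erase l).erase k, s i * sigmoid (y i) := by
        intro v y
        refine Finset.sum_congr rfl fun i hi => ?_
        rw [Function.update_of_ne (Finset.ne_of_mem_erase hi)]
      rcases hcase with ⟨h1, h2⟩ | ⟨h1, h2⟩
      · apply remove l hlK (Function.update s k (s k + s l)) c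
        intro y hy _ _
        rw [← Finset.add_sum_erase K _ hlK, ← Finset.add_sum_erase _ _ hkl,
          ← Finset.add_sum_erase (K.erase l) (fun i => Function.update s k (s k + s l) i * _) hkl,
          hupd, Function.update_self, hy l k h1 h2]
        ring
      · apply remove l hlK (Function.update s k (s k - s l)) (c + s l)
        intro y _ hy _
        rw [← Finset.add_sum_erase K _ hlK, ← Finset.add_sum_erase _ _ hkl,
          ← Finset.add_sum_erase (K.erase l) (fun i => Function.update s k (s k - s l) i * _) hkl,
          hupd, Function.update_self, hy l k h1 h2, sigmoid_neg']
        ring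
    · have hsk : s k = 0 := by
        have hc := cleared_zero K al b s c (fun j _ => h _)
          ((Real.pi * Complex.I - b k) / al k)
        have halC : (al k : ℂ) ≠ 0 := by exact_mod_cast h0
        set E := EE al b ((Real.pi * Complex.I - b k) / al k) with hE
        have hEk : 1 + E k = 0 := by
          rw [hE]; unfold EE
          rw [mul_div_cancel₀ _ halC, sub_add_cancel, Complex.exp_neg, Complex.exp_pi_mul_I]
          norm_num
        unfold cleared at hc
        rw [Finset.prod_eq_zero hk hEk, mul_zero, add_zero,
          Finset.sum_eq_single_of_mem k hk] at hc
        · rcases mul_eq_zero.mp hc with hc | hc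
          · exact Complex.ofReal_eq_zero.mp hc
          · exfalso
            obtain ⟨l, hl1, hl2⟩ := Finset.prod_eq_zero_iff.mp hc
            apply hl
            have hlK := Finset.mem_of_mem_erase hl1
            exact ⟨l, hlK, Finset.ne_of_mem_erase hl1,
              pole_sep (al k) (al l) (b k) (b l) h0 (hmax l hlK) hl2⟩
        · intro i _ hik
          rw [Finset.prod_eq_zero (Finset.mem_erase.mpr ⟨hik.symm, hk⟩) hEk, mul_zero]
      apply remove k hk s c
      intro y _ _ _
      rw [← Finset.add_sum_erase K _ hk, hsk]; ring

/-- moment curve -/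
noncomputable def mom (d : ℕ) (l : ℕ) : Fin d → ℝ := fun i => (l : ℝ) ^ (i : ℕ)

lemma dotp_sub {d : ℕ} (a b x : Fin d → ℝ) : dotp (a - b) x = dotp a x - dotp b x := by
  simp [dotp, sub_mul, Finset.sum_sub_distrib]

lemma mom_roots {d : ℕ} (hd : 0 < d) (w : Fin d → ℝ) (hw : w ≠ 0) (N : ℕ) :
    ((range N).filter (fun l => dotp w (mom d l) = 0)).card ≤ d - 1 := by
  classical
  set p : Polynomial ℝ := ∑ i : Fin d, Polynomial.C (w i) * Polynomial.X ^ (i : ℕ) with hp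
  have hcoef : ∀ i : Fin d, p.coeff i = w i := by
    intro i
    simp [hp, Polynomial.finset_sum_coeff, Polynomial.coeff_X_pow, Fin.val_inj]
  have hp0 : p ≠ 0 := by
    intro h
    apply hw
    funext i
    rw [← hcoef i, h]; simp
  have hdeg : p.natDegree ≤ d - 1 := by
    apply Polynomial.natDegree_sum_le_of_forall_le
    intro i _
    refine le_trans (Polynomial.natDegree_C_mul_X_pow_le _ _) ?_
    omega
  have hsub : ((range N).filter (fun l => dotp w (mom d l) = 0)).image (fun l : ℕ => (l : ℝ))
      ⊆ p.roots.toFinset := by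
    intro y hy
    obtain ⟨l, hl, rfl⟩ := Finset.mem_image.mp hy
    rw [Multiset.mem_toFinset, Polynomial.mem_roots hp0, Polynomial.IsRoot]
    have := (Finset.mem_filter.mp hl).2
    rw [← this]
    simp [hp, Polynomial.eval_finset_sum, dotp, mom]
  have := Finset.card_le_card hsub
  rw [Finset.card_image_of_injective _ Nat.cast_injective] at this
  exact this.trans ((Multiset.toFinset_card_le _).trans ((Polynomial.card_roots' p).trans hdeg))

lemma exists_good {J : Type*} [Fintype J] [DecidableEq J] {d : ℕ} (hd : 0 < d)
    (w : J → Fin d → ℝ) :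
    ∃ l ∈ range (Nat.choose (Fintype.card J) 2 * (d - 1) + 1),
      ∀ p q, dotp (w p) (mom d l) = dotp (w q) (mom d l) → w p = w q := by
  classical
  set N := Nat.choose (Fintype.card J) 2 * (d - 1) + 1 with hN
  by_contra hcon
  push Not at hcon
  set bad : Finset J → Finset ℕ := fun u => (range N).filter (fun l => ∃ p ∈ u, ∃ q ∈ u,
    dotp (w p) (mom d l) = dotp (w q) (mom d l) ∧ w p ≠ w q) with hbad
  have hcov : range N ⊆ (powersetCard 2 (univ : Finset J)).biUnion bad := by
    intro l hl
    obtain ⟨p, q, h1, h2⟩ := hcon l hl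
    have hpq : p ≠ q := fun h => h2 (by rw [h])
    refine Finset.mem_biUnion.mpr ⟨{p, q}, ?_, ?_⟩
    · rw [Finset.mem_powersetCard]
      exact ⟨Finset.subset_univ _, Finset.card_pair hpq⟩
    · exact Finset.mem_filter.mpr ⟨hl, p, by simp, q, by simp, h1, h2⟩
  have hb : ∀ u ∈ powersetCard 2 (univ : Finset J), (bad u).card ≤ d - 1 := by
    intro u hu
    obtain ⟨p, q, hpq, rfl⟩ := Finset.card_eq_two.mp (Finset.mem_powersetCard.mp hu).2
    by_cases hw : w p = w q
    · have : bad {p, q} = ∅ := by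
        apply Finset.filter_eq_empty_iff.mpr
        rintro l _ ⟨p', hp', q', hq', _, hne⟩
        simp only [Finset.mem_insert, Finset.mem_singleton] at hp' hq'
        rcases hp' with rfl | rfl <;> rcases hq' with rfl | rfl <;> simp_all
      rw [this]; simp
    · refine le_trans (Finset.card_le_card ?_) (mom_roots hd (w p - w q) (sub_ne_zero.mpr hw) N)
      intro l hl
      obtain ⟨hl, p', hp', q', hq', heq, hne⟩ := Finset.mem_filter.mp hl
      refine Finset.mem_filter.mpr ⟨hl, ?_⟩
      rw [dotp_sub, sub_eq_zero]
      simp only [Finset.mem_insert, Finset.mem_singleton] at hp' hq'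
      rcases hp' with rfl | rfl <;> rcases hq' with rfl | rfl <;> simp_all
  have h1 := Finset.card_le_card hcov
  have h2 := Finset.card_biUnion_le_card_mul _ bad (d - 1) hb
  rw [Finset.card_powersetCard, Finset.card_univ] at h2
  rw [Finset.card_range] at h1
  omega

noncomputable def pts (m d : ℕ) : Finset (Fin d → ℝ) := by
  classical
  exact (range (Nat.choose (4 * m) 2 * (d - 1) + 1) ×ˢ range (2 ^ (2 * m))).image
    (fun q => fun i => mom d q.1 i * ((q.2 : ℝ) + 1))

lemma pts_card (m d : ℕ) (hd : 0 < d) :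
    (pts m d).card = (Nat.choose (4 * m) 2 * (d - 1) + 1) * 2 ^ (2 * m) := by
  classical
  unfold pts
  rw [Finset.card_image_of_injOn, Finset.card_product, Finset.card_range, Finset.card_range]
  rintro ⟨l, j⟩ h1 ⟨l', j'⟩ h2 h
  simp only [Finset.coe_product, Set.mem_prod, Finset.mem_coe, Finset.mem_range] at h1 h2
  simp only at h
  have e0 := congrFun h ⟨0, hd⟩
  simp [mom] at e0
  subst e0
  by_cases hd1 : d = 1
  · subst hd1
    simp at h1 h2
    rw [h1.1, h2.1]
  · have e1 := congrFun h ⟨1, by omega⟩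
    have hj : (j : ℝ) + 1 ≠ 0 := by positivity
    simp only [mom, pow_one] at e1
    have := mul_right_cancel₀ hj e1
    rw [Nat.cast_injective this]

lemma core_sig (m d : ℕ) (hd : 0 < d) (a a' : Fin m → Fin d → ℝ) (b s b' s' : Fin m → ℝ)
    (c c' : ℝ)
    (h : ∀ x ∈ pts m d, shallowNet sigmoid a b s c x = shallowNet sigmoid a' b' s' c' x)
    (x : Fin d → ℝ) : shallowNet sigmoid a b s c x = shallowNet sigmoid a' b' s' c' x := by
  classical
  set A : Fin m ⊕ Fin m → Fin d → ℝ := Sum.elim a a' with hA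
  set B : Fin m ⊕ Fin m → ℝ := Sum.elim b b' with hB
  set S : Fin m ⊕ Fin m → ℝ := Sum.elim s (-s') with hS
  have hdiff : ∀ x, ∑ k, S k * sigmoid (dotp (A k) x + B k) + (c - c') =
      shallowNet sigmoid a b s c x - shallowNet sigmoid a' b' s' c' x := by
    intro x
    simp [hA, hB, hS, shallowNet, Fintype.sum_sum_type]
    ring
  obtain ⟨l, hl, hgood⟩ := exists_good hd
    (Sum.elim A (-A) : (Fin m ⊕ Fin m) ⊕ (Fin m ⊕ Fin m) → Fin d → ℝ)
  have hcard : Fintype.card ((Fin m ⊕ Fin m) ⊕ (Fin m ⊕ Fin m)) = 4 * m := by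
    simp; ring
  rw [hcard] at hl
  have hneg : ∀ u v : Fin d → ℝ, dotp (-u) v = - dotp u v := by
    intro u v; simp [dotp]
  rw [← sub_eq_zero, ← hdiff]
  apply main_ind A B (fun k => dotp (A k) (mom d l)) _ _ _ univ rfl S (c - c')
  · apply all_real univ (fun k => dotp (A k) (mom d l)) B S (c - c')
    intro j hj
    have hc : (univ : Finset (Fin m ⊕ Fin m)).card = 2 * m := by simp; ring
    rw [hc] at hj
    have hmem : (fun i => mom d l i * ((j : ℝ) + 1)) ∈ pts m d := by
      unfold pts
      exact Finset.mem_image.mpr ⟨(l, j), Finset.mem_product.mpr ⟨hl, hj⟩, rfl⟩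
    have h1 := hdiff (fun i => mom d l i * ((j : ℝ) + 1))
    rw [h _ hmem, sub_self] at h1
    rw [← h1]
    simp only [dotp, Finset.sum_mul, mul_assoc]
  · intro k l' hkl
    exact hgood (Sum.inl k) (Sum.inl l') hkl
  · intro k l' hkl
    have := hgood (Sum.inl k) (Sum.inr l') (by simpa [hneg] using hkl)
    simpa using this

lemma tanh_eq (x : ℝ) : Real.tanh x = 2 * sigmoid (2 * x) - 1 := by
  rw [Real.tanh_eq_sinh_div_cosh, Real.sinh_eq, Real.cosh_eq, sigmoid]
  have e : Real.exp (-(2 * x)) = Real.exp (-x) * Real.exp (-x) := by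
    rw [← Real.exp_add]; congr 1; ring
  rw [e, Real.exp_neg]
  have := Real.exp_pos x
  field_simp
  ring

lemma net_tanh {d m : ℕ} (a : Fin m → Fin d → ℝ) (b s : Fin m → ℝ) (c : ℝ) (x : Fin d → ℝ) :
    shallowNet Real.tanh a b s c x = shallowNet sigmoid (fun k i => 2 * a k i)
      (fun k => 2 * b k) (fun k => 2 * s k) (c - ∑ k, s k) x := by
  unfold shallowNet
  have : ∀ k, s k * Real.tanh (dotp (a k) x + b k) =
      2 * s k * sigmoid (dotp (fun i => 2 * a k i) x + 2 * b k) - s k := by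
    intro k
    have e : dotp (fun i => 2 * a k i) x + 2 * b k = 2 * (dotp (a k) x + b k) := by
      simp only [dotp, mul_add, Finset.mul_sum, mul_assoc]
    rw [tanh_eq, e]; ring
  rw [Finset.sum_congr rfl fun k _ => this k, Finset.sum_sub_distrib]
  ring

/-- Finite samples identify irreducible shallow analytic networks: there is a fixed
finite point set of cardinality `(C(4m,2)·(d−1)+1)·2^(2m)` on which agreement of two
irreducible `m`-neuron networks forces agreement everywhere. -/
theorem stmt10 (m d : ℕ) (hm : 0 < m) (hd : 0 < d)
    (σ : ℝ → ℝ) (hσ : σ = sigmoid ∨ σ = Real.tanh) :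
    ∃ X : Finset (Fin d → ℝ),
      X.card = (Nat.choose (4 * m) 2 * (d - 1) + 1) * 2 ^ (2 * m) ∧
      ∀ (a a' : Fin m → Fin d → ℝ) (b s b' s' : Fin m → ℝ) (c c' : ℝ),
        IrreducibleShallow σ m (shallowNet σ a b s c) →
        IrreducibleShallow σ m (shallowNet σ a' b' s' c') →
        (∀ x ∈ X, shallowNet σ a b s c x = shallowNet σ a' b' s' c' x) →
        ∀ x : Fin d → ℝ, shallowNet σ a b s c x = shallowNet σ a' b' s' c' x := by
  refine ⟨pts m d, pts_card m d hd, ?_⟩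
  intro a a' b s b' s' c c' _ _ h
  rcases hσ with rfl | rfl
  · exact core_sig m d hd a a' b s b' s' c c' h
  · simp only [net_tanh] at h ⊢
    exact core_sig m d hd _ _ _ _ _ _ _ _ h
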